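/- For all μ, ν ∈ Δ⁺_l, one has I(μ)_min ⊆ I(ν)_min if and only if ν ≼ μ. That is, the poset of the ideals I(μ)_min (μ ∈ Δ⁺_l) ordered by inclusion is anti-isomorphic to the poset (Δ⁺_l, ≼). -/

import Mathlib

open scoped BigOperators

/-- Data of a reduced irreducible crystallographic root system `Δ`, spanning a
`ℚ`-vector space `V` equipped with a Weyl-group-invariant inner product `B`,
together with a chosen system of positive roots `Pos` and the highest root `θ`. -/
structure RootSystemCtx (V : Type*) [AddCommGroup V] [Module ℚ V] where
  /-- the invariant inner product `( , )` -/
  B : V →ₗ[ℚ] V →ₗ[ℚ] ℚ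
  B_symm : ∀ x y : V, B x y = B y x
  B_posdef : ∀ x : V, x ≠ 0 → 0 < B x x
  /-- the set of roots -/
  Δ : Set V
  Δ_finite : Δ.Finite
  Δ_spans : Submodule.span ℚ Δ = ⊤
  zero_notMem_Δ : (0 : V) ∉ Δ
  neg_mem_Δ : ∀ α ∈ Δ, -α ∈ Δ
  reduced : ∀ α ∈ Δ, ∀ c : ℚ, c • α ∈ Δ → c = 1 ∨ c = -1
  crystallographic : ∀ α ∈ Δ, ∀ β ∈ Δ, ∃ n : ℤ, 2 * B α β / B β β = (n : ℚ)
  reflect_mem : ∀ α ∈ Δ, ∀ β ∈ Δ, β - (2 * B β α / B α α) • α ∈ Δ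
  irreducible : ∀ S : Set V, S ⊆ Δ → (∀ α ∈ S, ∀ β ∈ Δ \ S, B α β = 0) → S = ∅ ∨ S = Δ
  /-- the positive roots `Δ⁺` -/
  Pos : Set V
  pos_subset : Pos ⊆ Δ
  mem_pos_or_neg_pos : ∀ α ∈ Δ, α ∈ Pos ∨ -α ∈ Pos
  pos_not_neg : ∀ α ∈ Pos, -α ∉ Pos
  add_pos_mem : ∀ α ∈ Pos, ∀ β ∈ Pos, α + β ∈ Δ → α + β ∈ Pos
  /-- the highest root `θ` -/
  θ : V
  θ_pos : θ ∈ Pos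
  θ_highest : ∀ ν ∈ Δ, θ - ν ∈ AddSubmonoid.closure Pos

namespace RootSystemCtx

variable {V : Type*} [AddCommGroup V] [Module ℚ V] (ctx : RootSystemCtx V)

/-- the simple roots `Π`: indecomposable positive roots -/
def simple : Set V :=
  {α | α ∈ ctx.Pos ∧ ¬∃ β ∈ ctx.Pos, ∃ γ ∈ ctx.Pos, α = β + γ}

/-- `ρ`, the half-sum of all positive roots -/
noncomputable def ρ : V :=
  (1 / 2 : ℚ) • ∑ α ∈ (ctx.Δ_finite.subset ctx.pos_subset).toFinset, α

/-- the coroot `μ∨ = 2μ/(μ,μ)` -/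
noncomputable def coroot (μ : V) : V := (2 / ctx.B μ μ) • μ

/-- `Δ⁺_l`, the long positive roots (roots of the same length as `θ`) -/
def PosLong : Set V := {μ | μ ∈ ctx.Pos ∧ ctx.B μ μ = ctx.B ctx.θ ctx.θ}

/-- `Π_l`, the long simple roots -/
def SimpleLong : Set V := {μ | μ ∈ ctx.simple ∧ ctx.B μ μ = ctx.B ctx.θ ctx.θ}

/-- the dominance order `μ ≼ ν` on the root lattice: `ν - μ` is a nonnegative
integer combination of positive roots -/
def le (μ ν : V) : Prop := ν - μ ∈ AddSubmonoid.closure ctx.Pos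

/-- a (combinatorial) abelian ideal of `Δ⁺` -/
def IsAbelianIdeal (I : Set V) : Prop :=
  I ⊆ ctx.Pos ∧ (∀ μ ∈ I, ∀ ν ∈ I, μ + ν ∉ ctx.Δ) ∧
    ∀ γ ∈ I, ∀ ν ∈ ctx.Pos, γ + ν ∈ ctx.Δ → γ + ν ∈ I

/-- `γ` is a generator of the ideal `I` -/
def IsGenerator (I : Set V) (γ : V) : Prop := γ ∈ I ∧ ∀ α ∈ ctx.Pos, γ - α ∉ I

/-! ### The affine picture: `V̂ = V ⊕ ℚδ ⊕ ℚλ`, modelled as `V × ℚ × ℚ`,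
with `δ = (0,1,0)` and `λ = (0,0,1)`. -/

/-- the embedding of `V` into `V̂` -/
def emb (_ctx : RootSystemCtx V) (v : V) : V × ℚ × ℚ := (v, 0, 0)

/-- the imaginary root `δ` -/
def δhat (_ctx : RootSystemCtx V) : V × ℚ × ℚ := (0, 1, 0)

/-- the affine simple root `α₀ = δ - θ` -/
def alpha0 : V × ℚ × ℚ := (-ctx.θ, 1, 0)

/-- the extension of the inner product to `V̂`, with
`(δ,V)=(λ,V)=(δ,δ)=(λ,λ)=0` and `(δ,λ)=1` -/
noncomputable def Bhat : (V × ℚ × ℚ) →ₗ[ℚ] (V × ℚ × ℚ) →ₗ[ℚ] ℚ :=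
  LinearMap.mk₂ ℚ (fun x y => ctx.B x.1 y.1 + x.2.1 * y.2.2 + x.2.2 * y.2.1)
    (fun x x' y => by
      simp only [Prod.fst_add, Prod.snd_add, map_add, LinearMap.add_apply]; ring)
    (fun c x y => by
      simp only [Prod.smul_fst, Prod.smul_snd, map_smul, LinearMap.smul_apply,
        smul_eq_mul]; ring)
    (fun x y y' => by
      simp only [Prod.fst_add, Prod.snd_add, map_add]; ring)
    (fun c x y => by
      simp only [Prod.smul_fst, Prod.smul_snd, map_smul, smul_eq_mul]; ring)

/-- the set `Δ̂` of affine real roots -/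
def Δhat : Set (V × ℚ × ℚ) := {x | ∃ α ∈ ctx.Δ, ∃ k : ℤ, x = (α, (k : ℚ), 0)}

/-- the set `Δ̂⁺` of positive affine roots -/
def PosHat : Set (V × ℚ × ℚ) :=
  {x | ∃ α ∈ ctx.Pos, x = (α, 0, 0)} ∪
    {x | ∃ α ∈ ctx.Δ, ∃ k : ℤ, 1 ≤ k ∧ x = (α, (k : ℚ), 0)}

/-- the set `Π̂ = Π ∪ {α₀}` of affine simple roots -/
def SimpleHat : Set (V × ℚ × ℚ) :=
  {x | ∃ α ∈ ctx.simple, x = (α, (0 : ℚ), (0 : ℚ))} ∪ {ctx.alpha0}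

/-- the reflection `s_β : x ↦ x − (2(x,β)/(β,β))·β` in `V̂` -/
noncomputable def refl (β : V × ℚ × ℚ) : (V × ℚ × ℚ) ≃ₗ[ℚ] (V × ℚ × ℚ) :=
  if h : ctx.Bhat β β = 0 then LinearEquiv.refl ℚ _
  else
    Module.reflection (x := β) (f := (2 / ctx.Bhat β β) • ctx.Bhat β)
      (by simp only [LinearMap.smul_apply, smul_eq_mul]; field_simp)

/-- the affine Weyl group `Ŵ`, generated by the reflections `s_β`, `β ∈ Δ̂` -/
def What : Subgroup ((V × ℚ × ℚ) ≃ₗ[ℚ] (V × ℚ × ℚ)) :=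
  Subgroup.closure {g | ∃ β ∈ ctx.Δhat, g = ctx.refl β}

/-- the finite Weyl group `W`, generated by the reflections `s_α`, `α ∈ Δ`
(identified with a subgroup of `Ŵ`) -/
def Wfin : Subgroup ((V × ℚ × ℚ) ≃ₗ[ℚ] (V × ℚ × ℚ)) :=
  Subgroup.closure {g | ∃ α ∈ ctx.Δ, g = ctx.refl (α, (0 : ℚ), (0 : ℚ))}

/-- `N̂(w) = {β ∈ Δ̂⁺ : w(β) ∈ −Δ̂⁺}` -/
def Nhat (w : (V × ℚ × ℚ) ≃ₗ[ℚ] (V × ℚ × ℚ)) : Set (V × ℚ × ℚ) :=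
  {β | β ∈ ctx.PosHat ∧ -(w β) ∈ ctx.PosHat}

/-- a minuscule element of `Ŵ`: every element of `N̂(w)` has the form `δ - γ`
with `γ ∈ Δ⁺` -/
def IsMinuscule (w : (V × ℚ × ℚ) ≃ₗ[ℚ] (V × ℚ × ℚ)) : Prop :=
  w ∈ ctx.What ∧ ∀ β ∈ ctx.Nhat w, ∃ γ ∈ ctx.Pos, β = ctx.δhat - ctx.emb γ

/-- the abelian ideal `I_w` corresponding to a minuscule element `w` -/
def idealOf (w : (V × ℚ × ℚ) ≃ₗ[ℚ] (V × ℚ × ℚ)) : Set V :=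
  {γ | γ ∈ ctx.Pos ∧ ctx.δhat - ctx.emb γ ∈ ctx.Nhat w}

/-- the ideal `I` has rootlet `τ(I) = μ`, i.e. `I = I_w` for some minuscule `w`
with `w(α₀) + δ = μ` -/
def HasRootlet (I : Set V) (μ : V) : Prop :=
  ∃ w, ctx.IsMinuscule w ∧ ctx.idealOf w = I ∧ w ctx.alpha0 + ctx.δhat = ctx.emb μ

/-- `Ab_μ`, the set of nonempty abelian ideals with rootlet `μ` -/
def AbFiber (μ : V) : Set (Set V) := {I | I.Nonempty ∧ ctx.HasRootlet I μ}

/-- `N(u) = {γ ∈ Δ⁺ : u(γ) ∈ −Δ⁺}` for `u` in the finite Weyl group -/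
def Nfin (w : (V × ℚ × ℚ) ≃ₗ[ℚ] (V × ℚ × ℚ)) : Set V :=
  {γ | γ ∈ ctx.Pos ∧ -(w (ctx.emb γ)) ∈ ctx.PosHat}

/-- the length `l(u) = #N(u)` of an element of the finite Weyl group -/
noncomputable def lenFin (w : (V × ℚ × ℚ) ≃ₗ[ℚ] (V × ℚ × ℚ)) : ℕ :=
  (ctx.Nfin w).ncard

end RootSystemCtx

namespace RootSystemCtx

variable {V : Type*} [AddCommGroup V] [Module ℚ V] (ctx : RootSystemCtx V)

section PositiveSystem

variable {ctx}

lemma ne_zero_of_mem {α : V} (h : α ∈ ctx.Δ) : α ≠ 0 := fun h0 => ctx.zero_notMem_Δ (h0 ▸ h)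

lemma B_self_pos {α : V} (h : α ∈ ctx.Δ) : 0 < ctx.B α α := ctx.B_posdef α (ne_zero_of_mem h)

lemma pos_mem {α : V} (h : α ∈ ctx.Pos) : α ∈ ctx.Δ := ctx.pos_subset h

/-- If two distinct roots have positive inner product, then their difference is a root. -/
lemma sub_mem_of_B_pos {α β : V} (hα : α ∈ ctx.Δ) (hβ : β ∈ ctx.Δ) (hne : α ≠ β)
    (hB : 0 < ctx.B α β) : α - β ∈ ctx.Δ := by
  obtain ⟨p, hp⟩ := ctx.crystallographic α hα β hβ
  obtain ⟨q, hq⟩ := ctx.crystallographic β hβ α hα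
  have ha := B_self_pos hα
  have hb := B_self_pos hβ
  have hsymm := ctx.B_symm β α
  rw [hsymm] at hq
  have hp0 : (0 : ℚ) < p := by rw [← hp]; positivity
  have hq0 : (0 : ℚ) < q := by rw [← hq]; positivity
  have hx : α - (ctx.B α β / ctx.B β β) • β ≠ 0 := by
    intro h
    rw [sub_eq_zero] at h
    rcases ctx.reduced β hβ (ctx.B α β / ctx.B β β) (h ▸ hα) with h1 | h1
    · rw [h1, one_smul] at h; exact hne h
    · have : 0 < ctx.B α β / ctx.B β β := by positivity
      linarith
  have hcs := ctx.B_posdef _ hx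
  have hcs2 : ctx.B α β * ctx.B α β < ctx.B α α * ctx.B β β := by
    simp only [map_sub, map_smul, LinearMap.sub_apply, LinearMap.smul_apply, smul_eq_mul,
      hsymm] at hcs
    have h2 : ctx.B α α - ctx.B α β / ctx.B β β * ctx.B α β
        - ctx.B α β / ctx.B β β * (ctx.B α β - ctx.B α β / ctx.B β β * ctx.B β β)
        = (ctx.B α α * ctx.B β β - ctx.B α β * ctx.B α β) / ctx.B β β := by
      field_simp; ring
    have h3 : 0 < (ctx.B α α * ctx.B β β - ctx.B α β * ctx.B α β) / ctx.B β β := by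
      rw [← h2]; linarith
    have := (div_pos_iff_of_pos_right hb).1 h3
    linarith
  have hpq : (p : ℚ) * q < 4 := by
    rw [← hp, ← hq, div_mul_div_comm, div_lt_iff₀ (by positivity)]
    nlinarith
  have hp0' : 0 < p := by exact_mod_cast hp0
  have hq0' : 0 < q := by exact_mod_cast hq0
  have hpq' : p * q < 4 := by exact_mod_cast hpq
  have h1 : p = 1 ∨ q = 1 := by
    by_contra! h
    have : 2 ≤ p := by have := h.1; omega
    have : 2 ≤ q := by have := h.2; omega
    nlinarith
  rcases h1 with rfl | rfl
  · have := ctx.reflect_mem β hβ α hα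
    rw [hp] at this
    simpa using this
  · have := ctx.reflect_mem α hα β hβ
    rw [hsymm, hq] at this
    have := ctx.neg_mem_Δ _ this
    simpa using this

lemma add_mem_of_B_neg {α β : V} (hα : α ∈ ctx.Δ) (hβ : β ∈ ctx.Δ) (hne : α ≠ -β)
    (hB : ctx.B α β < 0) : α + β ∈ ctx.Δ := by
  have := sub_mem_of_B_pos hα (ctx.neg_mem_Δ β hβ) hne (by simpa using hB)
  simpa using this

lemma exists_mem_B_pos (y : V) (m : Multiset V) (h : 0 < ctx.B y m.sum) :
    ∃ b ∈ m, 0 < ctx.B y b := by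
  induction m using Multiset.induction with
  | empty => simp at h
  | cons a m ih =>
    rw [Multiset.sum_cons, map_add] at h
    by_cases ha : 0 < ctx.B y a
    · exact ⟨a, by simp, ha⟩
    · obtain ⟨b, hb, hb'⟩ := ih (by linarith)
      exact ⟨b, by simp [hb], hb'⟩

lemma multiset_sum_pos_ne_zero (n : ℕ) : ∀ m : Multiset V, m.card = n → (∀ x ∈ m, x ∈ ctx.Pos) →
    m.sum = 0 → m = 0 := by
  induction n using Nat.strong_induction_on with
  | _ n ih =>
    intro m hn hm hs
    induction m using Multiset.induction with
    | empty => rfl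
    | cons a m _ =>
      exfalso
      have ha := hm a (by simp)
      rw [Multiset.sum_cons] at hs
      have hms : m.sum = -a := by rw [eq_neg_iff_add_eq_zero, add_comm]; exact hs
      obtain ⟨b, hb, hab⟩ := exists_mem_B_pos (-a) m (by
        rw [hms]; simpa using B_self_pos (pos_mem ha))
      have hbP := hm b (by simp [hb])
      obtain ⟨m', rfl⟩ := Multiset.exists_cons_of_mem hb
      have habΔ : a + b ∈ ctx.Δ := add_mem_of_B_neg (pos_mem ha) (pos_mem hbP)
        (fun h => ctx.pos_not_neg b hbP (h ▸ ha)) (by simpa using hab)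
      have habP := ctx.add_pos_mem a ha b hbP habΔ
      have := ih (m'.card + 1) (by simp at hn; omega) ((a + b) ::ₘ m') (by simp) (by
        intro x hx
        rw [Multiset.mem_cons] at hx
        rcases hx with rfl | hx
        · exact habP
        · exact hm x (by simp [hx])) (by
          rw [Multiset.sum_cons] at hs ⊢; rw [← hs]; abel)
      simp at this

/-- The cone spanned by the positive roots is pointed. -/
lemma eq_zero_of_mem_closure_of_neg_mem {x : V} (h : x ∈ AddSubmonoid.closure ctx.Pos)
    (h' : -x ∈ AddSubmonoid.closure ctx.Pos) : x = 0 := by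
  obtain ⟨m, hm, rfl⟩ := AddSubmonoid.exists_multiset_of_mem_closure h
  obtain ⟨m', hm', hs⟩ := AddSubmonoid.exists_multiset_of_mem_closure h'
  have := multiset_sum_pos_ne_zero (ctx := ctx) _ (m + m') rfl (by
    intro x hx
    rcases Multiset.mem_add.1 hx with hx | hx
    · exact hm x hx
    · exact hm' x hx) (by simp [hs])
  have h0 : m = 0 := by
    rw [← Multiset.card_eq_zero] at this ⊢
    simp at this
    simp [this]
  simp [h0]

lemma pos_of_mem_closure {α : V} (h : α ∈ ctx.Δ) (h' : α ∈ AddSubmonoid.closure ctx.Pos) :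
    α ∈ ctx.Pos := by
  rcases ctx.mem_pos_or_neg_pos α h with h1 | h1
  · exact h1
  · exact absurd (eq_zero_of_mem_closure_of_neg_mem h' (AddSubmonoid.subset_closure h1))
      (ne_zero_of_mem h)

variable (ctx) in
/-- The strict dominance order. -/
def slt (x y : V) : Prop := y - x ∈ AddSubmonoid.closure ctx.Pos ∧ x ≠ y

instance : IsStrictOrder V ctx.slt where
  irrefl x h := h.2 rfl
  trans x y z hxy hyz := by
    have hs : z - x = (z - y) + (y - x) := by abel
    refine ⟨hs ▸ add_mem hyz.1 hxy.1, fun h => hxy.2 ?_⟩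
    subst h
    have := eq_zero_of_mem_closure_of_neg_mem hxy.1 (by simpa using hyz.1)
    exact (sub_eq_zero.1 this).symm

lemma slt_add_of_pos (x : V) {γ : V} (h : γ ∈ ctx.Pos) : ctx.slt x (x + γ) :=
  ⟨by simpa using AddSubmonoid.subset_closure h, by simpa using ne_zero_of_mem (pos_mem h)⟩

lemma Pos_finite : ctx.Pos.Finite := ctx.Δ_finite.subset ctx.pos_subset

lemma pos_mem_closure_simple {γ : V} (hγ : γ ∈ ctx.Pos) :
    γ ∈ AddSubmonoid.closure ctx.simple := by
  refine (Pos_finite.wellFoundedOn (r := ctx.slt)).induction hγ ?_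
  intro y hy ih
  by_cases hs : y ∈ ctx.simple
  · exact AddSubmonoid.subset_closure hs
  · obtain ⟨β, hβ, γ, hγ, rfl⟩ := not_not.1 fun h => hs ⟨hy, h⟩
    refine add_mem (ih β hβ (slt_add_of_pos _ hγ)) (ih γ hγ ?_)
    rw [add_comm]
    exact slt_add_of_pos _ hβ

lemma simple_subset : ctx.simple ⊆ ctx.Pos := fun _ h => h.1

lemma closure_simple : AddSubmonoid.closure ctx.simple = AddSubmonoid.closure ctx.Pos :=
  le_antisymm (AddSubmonoid.closure_mono simple_subset)
    (AddSubmonoid.closure_le.2 fun _ h => pos_mem_closure_simple h)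

lemma sub_simple_pos {α γ : V} (hα : α ∈ ctx.simple) (hγ : γ ∈ ctx.Pos) (hne : γ ≠ α)
    (hB : 0 < ctx.B γ α) : γ - α ∈ ctx.Pos := by
  have h := sub_mem_of_B_pos (pos_mem hγ) (pos_mem hα.1) hne hB
  rcases ctx.mem_pos_or_neg_pos _ h with h | h
  · exact h
  · exact absurd ⟨γ, hγ, _, h, by abel⟩ hα.2

lemma eq_simple_of_add_eq {α : V} (hα : α ∈ ctx.simple) (k : ℕ) : ∀ β ∈ ctx.Pos, ∀ γ ∈ ctx.Pos,
    γ + β = k • α → γ = α := by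
  have red : ∀ γ ∈ ctx.Pos, γ - α ≠ α := by
    intro γ hγ h
    have h2 : γ = (2 : ℚ) • α := by rw [two_smul, ← eq_add_of_sub_eq h]
    rcases ctx.reduced α (pos_mem hα.1) 2 (h2 ▸ pos_mem hγ) with h | h <;> norm_num at h
  induction k with
  | zero =>
    intro β hβ γ hγ h
    rw [zero_smul, add_eq_zero_iff_eq_neg] at h
    exact absurd (h ▸ hγ) (ctx.pos_not_neg β hβ)
  | succ k ih =>
    intro β hβ γ hγ h
    by_contra hne
    have h0 : 0 < ctx.B γ α + ctx.B β α := by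
      rw [← LinearMap.add_apply, ← map_add, h, map_nsmul, LinearMap.smul_apply, nsmul_eq_mul]
      have := B_self_pos (pos_mem hα.1)
      positivity
    rw [succ_nsmul] at h
    by_cases h1 : 0 < ctx.B γ α
    · exact red γ hγ (ih β hβ _ (sub_simple_pos hα hγ hne h1) (by
        rw [sub_add_eq_add_sub, h]; abel))
    · by_cases hβα : β = α
      · subst hβα
        have hγk : γ = (k : ℚ) • β := by
          rw [Nat.cast_smul_eq_nsmul]; exact add_right_cancel h
        rcases ctx.reduced β (pos_mem hβ) k (hγk ▸ pos_mem hγ) with h2 | h2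
        · exact hne (by rw [hγk, h2, one_smul])
        · have : (0 : ℚ) ≤ k := by positivity
          linarith
      · exact red β hβ (ih γ hγ _ (sub_simple_pos hα hβ hβα (by linarith)) (by
          rw [sub_add_eq_add_sub, add_comm β γ, h]; abel))

end PositiveSystem

section FiniteWeylGroup

/-- The reflection of `V` in the vector `α`. -/
noncomputable def sr (α : V) : V ≃ₗ[ℚ] V :=
  LinearEquiv.ofInvolutive
    { toFun := fun x => x - (2 * ctx.B x α / ctx.B α α) • α
      map_add' := fun x y => by
        rw [map_add, LinearMap.add_apply, mul_add, add_div, add_smul]; abel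
      map_smul' := fun c x => by
        simp only [map_smul, LinearMap.smul_apply, smul_eq_mul, RingHom.id_apply, smul_sub,
          smul_smul]
        congr 2
        ring }
    (fun x => by
      change x - (2 * ctx.B x α / ctx.B α α) • α
        - (2 * ctx.B (x - (2 * ctx.B x α / ctx.B α α) • α) α / ctx.B α α) • α = x
      have e : 2 * ctx.B (x - (2 * ctx.B x α / ctx.B α α) • α) α / ctx.B α α
          = -(2 * ctx.B x α / ctx.B α α) := by
        rw [map_sub, LinearMap.sub_apply, map_smul, LinearMap.smul_apply, smul_eq_mul]
        by_cases h : ctx.B α α = 0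
        · simp [h]
        · field_simp
          ring
      rw [e, neg_smul]
      abel)

lemma sr_apply (α x : V) : ctx.sr α x = x - (2 * ctx.B x α / ctx.B α α) • α := rfl

lemma sr_sr (α x : V) : ctx.sr α (ctx.sr α x) = x := (ctx.sr α).left_inv x

lemma sr_mul_self (α : V) : ctx.sr α * ctx.sr α = 1 := LinearEquiv.ext (ctx.sr_sr α)

/-- The finite Weyl group acting on `V`, generated by the simple reflections. -/
def weyl : Subgroup (V ≃ₗ[ℚ] V) := Subgroup.closure (ctx.sr '' ctx.simple)

/-- The product of the reflections in the vectors of a list. -/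
noncomputable def word (l : List V) : V ≃ₗ[ℚ] V := (l.map ctx.sr).prod

variable {ctx}

lemma sr_self {α : V} (h : α ∈ ctx.Δ) : ctx.sr α α = -α := by
  rw [sr_apply, mul_div_assoc, div_self (B_self_pos h).ne', mul_one, two_smul]
  abel

lemma B_sr_sr (α x y : V) : ctx.B (ctx.sr α x) (ctx.sr α y) = ctx.B x y := by
  simp only [sr_apply, map_sub, map_smul, LinearMap.sub_apply, LinearMap.smul_apply, smul_eq_mul,
    ctx.B_symm α y]
  by_cases h : ctx.B α α = 0
  · simp [h]
  · field_simp
    ring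

lemma B_sr_left (α x y : V) : ctx.B (ctx.sr α x) y = ctx.B x (ctx.sr α y) := by
  rw [← B_sr_sr α x, sr_sr]

lemma sr_mem {α x : V} (hα : α ∈ ctx.Δ) (hx : x ∈ ctx.Δ) : ctx.sr α x ∈ ctx.Δ :=
  ctx.reflect_mem α hα x hx

/-- A simple reflection permutes the positive roots other than its own root. -/
lemma sr_mem_pos {α γ : V} (hα : α ∈ ctx.simple) (hγ : γ ∈ ctx.Pos) (hne : γ ≠ α) :
    ctx.sr α γ ∈ ctx.Pos := by
  have hΔ := sr_mem (pos_mem hα.1) (pos_mem hγ)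
  obtain ⟨n, hn⟩ := ctx.crystallographic γ (pos_mem hγ) α (pos_mem hα.1)
  rcases ctx.mem_pos_or_neg_pos _ hΔ with h | h
  · exact h
  · rw [sr_apply, hn] at h hΔ ⊢
    rcases le_total 0 n with h0 | h0
    · lift n to ℕ using h0
      refine absurd (eq_simple_of_add_eq hα n _ h γ hγ ?_) hne
      rw [Int.cast_natCast, Nat.cast_smul_eq_nsmul]
      abel
    · obtain ⟨k, rfl⟩ : ∃ k : ℕ, n = -(k : ℤ) := ⟨n.natAbs, by omega⟩
      refine pos_of_mem_closure hΔ ?_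
      rw [Int.cast_neg, Int.cast_natCast, neg_smul, Nat.cast_smul_eq_nsmul, sub_neg_eq_add]
      exact add_mem (AddSubmonoid.subset_closure hγ)
        (nsmul_mem (AddSubmonoid.subset_closure hα.1) k)

lemma sr_mem_weyl {α : V} (hα : α ∈ ctx.simple) : ctx.sr α ∈ ctx.weyl :=
  Subgroup.subset_closure ⟨α, hα, rfl⟩

lemma weyl_B {v : V ≃ₗ[ℚ] V} (hv : v ∈ ctx.weyl) : ∀ x y, ctx.B (v x) (v y) = ctx.B x y := by
  induction hv using Subgroup.closure_induction with
  | mem g hg => obtain ⟨α, -, rfl⟩ := hg; exact B_sr_sr α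
  | one => intro x y; rfl
  | mul a b _ _ ha hb => intro x y; rw [LinearEquiv.mul_apply, LinearEquiv.mul_apply, ha, hb]
  | inv a _ ha =>
    intro x y
    rw [← ha (a⁻¹ x), ← LinearEquiv.mul_apply, ← LinearEquiv.mul_apply, mul_inv_cancel]
    rfl

lemma weyl_mem {v : V ≃ₗ[ℚ] V} (hv : v ∈ ctx.weyl) : ∀ x ∈ ctx.Δ, v x ∈ ctx.Δ := by
  induction hv using Subgroup.closure_induction'' with
  | one => intro x hx; exact hx
  | mem g hg => obtain ⟨α, hα, rfl⟩ := hg; exact fun x hx => sr_mem (pos_mem hα.1) hx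
  | inv_mem g hg =>
    obtain ⟨α, hα, rfl⟩ := hg
    rw [inv_eq_of_mul_eq_one_left (ctx.sr_mul_self α)]
    exact fun x hx => sr_mem (pos_mem hα.1) hx
  | mul a b _ _ ha hb => intro x hx; exact ha _ (hb x hx)

lemma word_nil : ctx.word [] = 1 := rfl

lemma word_cons (α : V) (l : List V) : ctx.word (α :: l) = ctx.sr α * ctx.word l := by
  simp [word]

lemma word_append (l l' : List V) : ctx.word (l ++ l') = ctx.word l * ctx.word l' := by
  simp [word]

lemma exists_word {v : V ≃ₗ[ℚ] V} (hv : v ∈ ctx.weyl) :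
    ∃ l : List V, (∀ α ∈ l, α ∈ ctx.simple) ∧ ctx.word l = v := by
  induction hv using Subgroup.closure_induction'' with
  | one => exact ⟨[], by simp, rfl⟩
  | mem g hg =>
    obtain ⟨α, hα, rfl⟩ := hg
    exact ⟨[α], by simpa using hα, by simp [word]⟩
  | inv_mem g hg =>
    obtain ⟨α, hα, rfl⟩ := hg
    rw [inv_eq_of_mul_eq_one_left (ctx.sr_mul_self α)]
    exact ⟨[α], by simpa using hα, by simp [word]⟩
  | mul a b _ _ ha hb =>
    obtain ⟨l, hl, rfl⟩ := ha
    obtain ⟨l', hl', rfl⟩ := hb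
    refine ⟨l ++ l', ?_, word_append l l'⟩
    intro α hα
    rcases List.mem_append.1 hα with h | h
    · exact hl α h
    · exact hl' α h

lemma word_mem_weyl {l : List V} (hl : ∀ α ∈ l, α ∈ ctx.simple) : ctx.word l ∈ ctx.weyl := by
  induction l with
  | nil => exact one_mem _
  | cons α l ih =>
    rw [word_cons]
    exact mul_mem (sr_mem_weyl (hl α (by simp))) (ih fun β hβ => hl β (by simp [hβ]))

/-- The exchange condition. -/
lemma exists_exchange {α : V} (hα : α ∈ ctx.simple) (l : List V) :
    (∀ β ∈ l, β ∈ ctx.simple) → -(ctx.word l α) ∈ ctx.Pos →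
    ∃ l' : List V, (∀ β ∈ l', β ∈ ctx.simple) ∧ l'.length + 1 = l.length ∧
      ctx.word l' = ctx.word l * ctx.sr α := by
  induction l with
  | nil => intro _ h; exact absurd h (ctx.pos_not_neg α hα.1)
  | cons β t ih =>
    intro hl h
    have ht : ∀ γ ∈ t, γ ∈ ctx.simple := fun γ hγ => hl γ (by simp [hγ])
    have hβ : β ∈ ctx.simple := hl β (by simp)
    rcases ctx.mem_pos_or_neg_pos _ (weyl_mem (word_mem_weyl ht) α (pos_mem hα.1)) with hp | hp
    · have hEq : ctx.word t α = β := by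
        by_contra hne
        rw [word_cons, LinearEquiv.mul_apply] at h
        exact ctx.pos_not_neg _ (sr_mem_pos hβ hp hne) h
      refine ⟨t, ht, rfl, LinearEquiv.ext fun x => ?_⟩
      rw [word_cons, LinearEquiv.mul_apply, LinearEquiv.mul_apply, ← hEq, sr_apply,
        weyl_B (word_mem_weyl ht), weyl_B (word_mem_weyl ht), ← map_smul, ← map_sub]
      congr 1
      rw [← sr_apply, sr_sr]
    · obtain ⟨t', ht', hlen, hw⟩ := ih ht hp
      refine ⟨β :: t', ?_, by simp [hlen], by rw [word_cons, word_cons, hw, mul_assoc]⟩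
      intro γ hγ
      rcases List.mem_cons.1 hγ with rfl | hγ
      · exact hβ
      · exact ht' γ hγ

lemma sub_word_mem_closure (n : ℕ) : ∀ l : List V, l.length = n → (∀ β ∈ l, β ∈ ctx.simple) →
    ∀ μ ∈ ctx.Δ, (∀ β ∈ ctx.Pos, -(ctx.word l β) ∈ ctx.Pos → 0 ≤ ctx.B β μ) →
    μ - ctx.word l μ ∈ AddSubmonoid.closure ctx.Pos := by
  induction n using Nat.strong_induction_on with
  | _ n ih =>
    intro l hn hl μ hμ h
    by_cases hex : ∃ α ∈ ctx.simple, -(ctx.word l α) ∈ ctx.Pos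
    · obtain ⟨α, hα, hneg⟩ := hex
      obtain ⟨l', hl', hlen, hw⟩ := exists_exchange hα l hl hneg
      have key := ih l'.length (by omega) l' rfl hl' (ctx.sr α μ) (sr_mem (pos_mem hα.1) hμ) (by
        intro β hβ hβn
        rw [hw, LinearEquiv.mul_apply] at hβn
        have hne : β ≠ α := by
          rintro rfl
          rw [sr_self (pos_mem hβ), map_neg] at hβn
          exact ctx.pos_not_neg _ hneg hβn
        rw [← B_sr_left]
        exact h _ (sr_mem_pos hα hβ hne) hβn)
      rw [hw, LinearEquiv.mul_apply, sr_sr] at key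
      obtain ⟨k, hk⟩ := ctx.crystallographic μ hμ α (pos_mem hα.1)
      have hk0 : (0 : ℚ) ≤ k := by
        rw [← hk, ctx.B_symm]
        have := h α hα.1 hneg
        have := B_self_pos (pos_mem hα.1)
        positivity
      lift k to ℕ using by exact_mod_cast hk0
      have hs : μ - ctx.word l μ = k • α + (ctx.sr α μ - ctx.word l μ) := by
        rw [sr_apply, hk, Int.cast_natCast, Nat.cast_smul_eq_nsmul]; abel
      rw [hs]
      exact add_mem (nsmul_mem (AddSubmonoid.subset_closure hα.1) k) key
    · rcases List.eq_nil_or_concat l with rfl | ⟨t, α, rfl⟩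
      · simp [word_nil]
      · have ht : ∀ γ ∈ t, γ ∈ ctx.simple := fun γ hγ => hl γ (by simp [hγ])
        have hα : α ∈ ctx.simple := hl α (by simp)
        have hw : ctx.word (t ++ [α]) = ctx.word t * ctx.sr α := by simp [word]
        have hp : -(ctx.word t α) ∈ ctx.Pos := by
          rcases ctx.mem_pos_or_neg_pos _ (weyl_mem (word_mem_weyl ht) α (pos_mem hα.1)) with hp | hp
          · refine absurd ⟨α, hα, ?_⟩ hex
            simpa [hw, sr_self (pos_mem hα.1)] using hp
          · exact hp
        obtain ⟨t', ht', hlen, hw'⟩ := exists_exchange hα t ht hp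
        have e : ctx.word (t ++ [α]) = ctx.word t' := by rw [hw, hw']
        simp only [List.concat_eq_append] at h hn ⊢
        rw [e] at h ⊢
        exact ih t'.length (by simp at hn; omega) t' rfl ht' μ hμ h

end FiniteWeylGroup

section HighestRoot

variable {ctx}

lemma θ_mem : ctx.θ ∈ ctx.Δ := pos_mem ctx.θ_pos

lemma eq_of_θ_add_mem {x : V} (hx : x ∈ AddSubmonoid.closure ctx.Pos)
    (h : ctx.θ + x ∈ ctx.Δ) : x = 0 :=
  eq_zero_of_mem_closure_of_neg_mem hx (by simpa using ctx.θ_highest _ h)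

lemma nonneg_B_of_mem_closure {S : Set V} {y : V} (hy : ∀ γ ∈ S, 0 ≤ ctx.B y γ) {x : V}
    (hx : x ∈ AddSubmonoid.closure S) : 0 ≤ ctx.B y x := by
  induction hx using AddSubmonoid.closure_induction with
  | mem x h => exact hy x h
  | zero => simp
  | add a b _ _ ha hb => rw [map_add]; exact add_nonneg ha hb

lemma θ_dominant {γ : V} (hγ : γ ∈ ctx.Pos) : 0 ≤ ctx.B ctx.θ γ := by
  by_contra! h
  have hne : ctx.θ ≠ -γ := fun e => ctx.pos_not_neg γ hγ (e ▸ ctx.θ_pos)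
  exact ne_zero_of_mem (pos_mem hγ) (eq_of_θ_add_mem (AddSubmonoid.subset_closure hγ)
    (add_mem_of_B_neg θ_mem (pos_mem hγ) hne h))

/-- Every root other than `θ` pairs with the coroot of `θ` to at most `1`. -/
lemma two_B_θ_le {a : V} (ha : a ∈ ctx.Δ) (hne : a ≠ ctx.θ) :
    2 * ctx.B a ctx.θ ≤ ctx.B ctx.θ ctx.θ := by
  obtain ⟨n, hn⟩ := ctx.crystallographic a ha _ θ_mem
  have hθ := B_self_pos (ctx := ctx) θ_mem
  rw [div_eq_iff hθ.ne'] at hn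
  by_contra! hlt
  have hn1 : (1 : ℚ) < n := by
    by_contra! hle
    nlinarith
  have hn2 : (2 : ℚ) ≤ n := by
    have : 1 < n := by exact_mod_cast hn1
    exact_mod_cast (by omega : 2 ≤ n)
  have hge : ctx.B ctx.θ ctx.θ ≤ ctx.B a ctx.θ := by nlinarith
  have hγΔ : ctx.θ - a ∈ ctx.Δ :=
    sub_mem_of_B_pos θ_mem ha hne.symm (by rw [ctx.B_symm]; linarith)
  have hγ : ctx.θ - a ∈ ctx.Pos := pos_of_mem_closure hγΔ (ctx.θ_highest a ha)
  have h1 := θ_dominant hγ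
  rw [map_sub, ctx.B_symm _ a] at h1
  have hEq : ctx.B a ctx.θ = ctx.B ctx.θ ctx.θ := by linarith
  have hγ0 : ctx.B ctx.θ (ctx.θ - a) = 0 := by rw [map_sub, ctx.B_symm _ a, hEq, sub_self]
  have hs : ctx.sr (ctx.θ - a) a = ctx.θ + (ctx.θ - a) := by
    have haθ : a = ctx.θ - (ctx.θ - a) := by abel
    conv_lhs => rw [haθ, map_sub, sub_sub_cancel, sr_self hγΔ, sr_apply, hγ0]
    simp only [mul_zero, zero_div, zero_smul, sub_zero, sub_neg_eq_add]
  exact ne_zero_of_mem hγΔ (eq_of_θ_add_mem (AddSubmonoid.subset_closure hγ)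
    (hs ▸ sr_mem hγΔ ha))

lemma neg_B_θ_le {a : V} (ha : a ∈ ctx.Δ) (hne : a ≠ -ctx.θ) :
    -ctx.B ctx.θ ctx.θ ≤ 2 * ctx.B a ctx.θ := by
  have := two_B_θ_le (ctx.neg_mem_Δ a ha) (fun h => hne (by rw [← h, neg_neg]))
  rw [map_neg, LinearMap.neg_apply] at this
  linarith

lemma eq_θ_of_dominant {μ : V} (hμ : μ ∈ ctx.PosLong)
    (hdom : ∀ α ∈ ctx.simple, 0 ≤ ctx.B μ α) : μ = ctx.θ := by
  by_contra hne
  have h1 := nonneg_B_of_mem_closure hdom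
    (closure_simple (ctx := ctx) ▸ ctx.θ_highest μ (pos_mem hμ.1))
  rw [map_sub, hμ.2] at h1
  have h2 := two_B_θ_le (pos_mem hμ.1) hne
  have := B_self_pos (ctx := ctx) θ_mem
  linarith

variable (ctx) in
/-- `v` is the element of minimal length of the Weyl group sending `θ` to `μ`. -/
structure IsMinRep (v : V ≃ₗ[ℚ] V) (μ : V) : Prop where
  mem : v ∈ ctx.weyl
  map_θ : v ctx.θ = μ
  symm_pos : ∀ γ ∈ ctx.Pos, 0 ≤ ctx.B γ μ → v.symm γ ∈ ctx.Pos

lemma weyl_symm_mem {v : V ≃ₗ[ℚ] V} (hv : v ∈ ctx.weyl) : ∀ x ∈ ctx.Δ, v.symm x ∈ ctx.Δ :=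
  weyl_mem (inv_mem hv)

lemma IsMinRep.B_θ {v : V ≃ₗ[ℚ] V} {μ : V} (h : ctx.IsMinRep v μ) (x : V) :
    ctx.B (v x) μ = ctx.B x ctx.θ := by rw [← h.map_θ, weyl_B h.mem]

lemma IsMinRep.B_symm {v : V ≃ₗ[ℚ] V} {μ : V} (h : ctx.IsMinRep v μ) (x : V) :
    ctx.B (v.symm x) ctx.θ = ctx.B x μ := by rw [← h.B_θ, LinearEquiv.apply_symm_apply]

lemma IsMinRep.neg_symm_pos {v : V ≃ₗ[ℚ] V} {μ : V} (h : ctx.IsMinRep v μ) {γ : V}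
    (hγ : γ ∈ ctx.Δ) (hB : ctx.B γ μ < 0) : -v.symm γ ∈ ctx.Pos := by
  rcases ctx.mem_pos_or_neg_pos _ (weyl_symm_mem h.mem γ hγ) with h' | h'
  · have := θ_dominant h'
    rw [ctx.B_symm, h.B_symm] at this
    linarith
  · exact h'

lemma IsMinRep.sr_mul {v : V ≃ₗ[ℚ] V} {μ α : V} (h : ctx.IsMinRep v μ) (hα : α ∈ ctx.simple)
    (hne : ctx.B α μ ≠ 0) : ctx.IsMinRep (ctx.sr α * v) (ctx.sr α μ) where
  mem := mul_mem (sr_mem_weyl hα) h.mem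
  map_θ := by rw [LinearEquiv.mul_apply, h.map_θ]
  symm_pos := by
    intro γ hγ hB
    change v.symm (ctx.sr α γ) ∈ ctx.Pos
    rw [← B_sr_left] at hB
    by_cases hγα : γ = α
    · subst hγα
      rw [sr_self (pos_mem hγ)] at hB ⊢
      rw [map_neg]
      refine h.neg_symm_pos (pos_mem hγ) (lt_of_le_of_ne ?_ hne)
      simpa using hB
    · exact h.symm_pos _ (sr_mem_pos hα hγ hγα) hB

lemma sr_mem_posLong {α μ : V} (hα : α ∈ ctx.simple) (hμ : μ ∈ ctx.PosLong) (hne : μ ≠ α) :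
    ctx.sr α μ ∈ ctx.PosLong :=
  ⟨sr_mem_pos hα hμ.1 hne, by rw [B_sr_sr, hμ.2]⟩

lemma slt_sr {α μ : V} (hα : α ∈ ctx.simple) (hμ : μ ∈ ctx.Δ) (hB : ctx.B μ α < 0) :
    ctx.slt μ (ctx.sr α μ) := by
  obtain ⟨n, hn⟩ := ctx.crystallographic μ hμ α (pos_mem hα.1)
  have hαα := B_self_pos (pos_mem hα.1)
  have hn0 : (n : ℚ) < 0 := by
    rw [← hn]
    exact div_neg_of_neg_of_pos (by linarith) hαα
  have hn0' : n < 0 := by exact_mod_cast hn0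
  obtain ⟨k, rfl⟩ : ∃ k : ℕ, n = -(k : ℤ) := ⟨n.natAbs, by omega⟩
  have hs : ctx.sr α μ = μ + k • α := by
    rw [sr_apply, hn, Int.cast_neg, Int.cast_natCast, neg_smul, Nat.cast_smul_eq_nsmul,
      sub_neg_eq_add]
  refine ⟨?_, fun h => ?_⟩
  · rw [hs, add_sub_cancel_left]
    exact nsmul_mem (AddSubmonoid.subset_closure hα.1) k
  · have := B_sr_left (ctx := ctx) α μ α
    rw [← h, sr_self (pos_mem hα.1), map_neg] at this
    linarith

lemma weyl_one_isMinRep : ctx.IsMinRep 1 ctx.θ := ⟨one_mem _, rfl, fun _ hγ _ => hγ⟩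

lemma exists_isMinRep {μ : V} (hμ : μ ∈ ctx.PosLong) : ∃ v, ctx.IsMinRep v μ := by
  have hfin : ctx.PosLong.Finite := Pos_finite.subset fun _ h => h.1
  refine (hfin.wellFoundedOn (r := Function.swap ctx.slt)).induction
    (P := fun μ => ∃ v, ctx.IsMinRep v μ) hμ ?_
  intro μ hμ ih
  by_cases hdom : ∀ α ∈ ctx.simple, 0 ≤ ctx.B μ α
  · exact ⟨1, eq_θ_of_dominant hμ hdom ▸ weyl_one_isMinRep⟩
  · push Not at hdom
    obtain ⟨α, hα, hB⟩ := hdom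
    have hne : μ ≠ α := by
      rintro rfl
      exact absurd (B_self_pos (pos_mem hμ.1)) (not_lt.2 hB.le)
    obtain ⟨v, hv⟩ := ih _ (sr_mem_posLong hα hμ hne) (slt_sr hα (pos_mem hμ.1) hB)
    refine ⟨ctx.sr α * v, ?_⟩
    have := hv.sr_mul hα (by
      rw [ctx.B_symm, B_sr_left, sr_self (pos_mem hα.1), map_neg]
      linarith)
    rwa [sr_sr] at this

/-- A simple reflection moves a long positive root by a fixed multiple of the simple root. -/
lemma sr_eq_sub {α μ : V} (hα : α ∈ ctx.simple) (hμ : μ ∈ ctx.PosLong) (hne : μ ≠ α)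
    (hB : 0 < ctx.B μ α) :
    ctx.sr α μ = μ - (ctx.B ctx.θ ctx.θ / ctx.B α α) • α := by
  obtain ⟨v, hv⟩ := exists_isMinRep hμ
  obtain ⟨n, hn⟩ := ctx.crystallographic α (pos_mem hα.1) μ (pos_mem hμ.1)
  have h1 := two_B_θ_le (weyl_symm_mem hv.mem α (pos_mem hα.1)) (fun h => hne (by
    rw [← hv.map_θ, ← h, LinearEquiv.apply_symm_apply]))
  have hθ := B_self_pos (ctx := ctx) θ_mem
  rw [hv.B_symm] at h1
  rw [hμ.2, div_eq_iff hθ.ne'] at hn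
  rw [ctx.B_symm] at hB
  have hn0 : (0 : ℚ) < n := by
    by_contra! hle
    nlinarith
  have hn1 : (n : ℚ) ≤ 1 := by
    by_contra! hle
    nlinarith
  have : n = 1 := by
    have : 0 < n := by exact_mod_cast hn0
    have : n ≤ 1 := by exact_mod_cast hn1
    omega
  rw [sr_apply, ctx.B_symm μ, hn, this, Int.cast_one, one_mul]

lemma sr_eq_add {α μ : V} (hα : α ∈ ctx.simple) (hμ : μ ∈ ctx.PosLong)
    (hB : ctx.B μ α < 0) :
    ctx.sr α μ = μ + (ctx.B ctx.θ ctx.θ / ctx.B α α) • α := by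
  have hne : μ ≠ α := by
    rintro rfl
    exact absurd (B_self_pos (pos_mem hμ.1)) (not_lt.2 hB.le)
  have hne' : ctx.sr α μ ≠ α := by
    intro h
    have := sr_sr ctx α μ
    rw [h, sr_self (pos_mem hα.1)] at this
    exact ctx.pos_not_neg α hα.1 (this ▸ hμ.1)
  have h := sr_eq_sub hα (sr_mem_posLong hα hμ hne) hne' (by
    rw [B_sr_left, sr_self (pos_mem hα.1), map_neg]
    linarith)
  rw [sr_sr] at h
  exact (sub_eq_iff_eq_add.1 h.symm)

end HighestRoot

section SimpleCoordinates

variable {ctx}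

variable (ctx) in
/-- The sum of all positive roots. -/
noncomputable def posSum : V := ∑ β ∈ (Pos_finite (ctx := ctx)).toFinset, β

lemma sr_posSum {α : V} (hα : α ∈ ctx.simple) : ctx.sr α ctx.posSum = ctx.posSum - (2 : ℚ) • α := by
  classical
  have hmem : α ∈ (Pos_finite (ctx := ctx)).toFinset := by simpa using hα.1
  have hperm : ∀ β ∈ (Pos_finite (ctx := ctx)).toFinset.erase α,
      ctx.sr α β ∈ (Pos_finite (ctx := ctx)).toFinset.erase α := by
    intro β hβ
    simp only [Finset.mem_erase, Set.Finite.mem_toFinset] at hβ ⊢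
    refine ⟨fun h => ?_, sr_mem_pos hα hβ.2 hβ.1⟩
    have h2 := sr_sr ctx α β
    rw [h, sr_self (pos_mem hα.1)] at h2
    exact ctx.pos_not_neg α hα.1 (h2 ▸ hβ.2)
  have hs : ∑ β ∈ (Pos_finite (ctx := ctx)).toFinset.erase α, ctx.sr α β
      = ∑ β ∈ (Pos_finite (ctx := ctx)).toFinset.erase α, β :=
    Finset.sum_nbij' (ctx.sr α) (ctx.sr α) hperm hperm (fun β _ => sr_sr ctx α β)
      (fun β _ => sr_sr ctx α β) (fun β _ => rfl)
  rw [posSum, ← Finset.add_sum_erase _ _ hmem, map_add, map_sum, hs, sr_self (pos_mem hα.1),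
    two_smul]
  abel

lemma B_posSum_simple {α : V} (hα : α ∈ ctx.simple) : 0 < ctx.B ctx.posSum α := by
  have h := B_sr_left (ctx := ctx) α ctx.posSum α
  rw [sr_posSum hα, sr_self (pos_mem hα.1)] at h
  simp only [map_sub, map_smul, map_neg, LinearMap.sub_apply, LinearMap.smul_apply,
    smul_eq_mul] at h
  have := B_self_pos (pos_mem hα.1)
  linarith

lemma B_posSum_pos {γ : V} (hγ : γ ∈ ctx.Pos) : 0 < ctx.B ctx.posSum γ := by
  have h : γ = 0 ∨ 0 < ctx.B ctx.posSum γ := by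
    have := pos_mem_closure_simple hγ
    clear hγ
    induction this using AddSubmonoid.closure_induction with
    | mem x h => exact Or.inr (B_posSum_simple h)
    | zero => exact Or.inl rfl
    | add a b _ _ ha hb =>
      rcases ha with rfl | ha
      · simpa using hb
      · rcases hb with rfl | hb
        · simpa using Or.inr ha
        · exact Or.inr (by rw [map_add]; exact add_pos ha hb)
  exact h.resolve_left (ne_zero_of_mem (pos_mem hγ))

lemma simple_B_nonpos {α β : V} (hα : α ∈ ctx.simple) (hβ : β ∈ ctx.simple) (hne : α ≠ β) :
    ctx.B α β ≤ 0 := by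
  by_contra! h
  exact hα.2 ⟨β, hβ.1, _, sub_simple_pos hβ hα.1 hne h, by abel⟩

lemma linearIndependent_simple : LinearIndependent ℚ (fun i : ctx.simple => (i : V)) :=
  LinearMap.BilinForm.linearIndependent_of_pairwise_le_zero ctx.B
    (fun x hx => ctx.B_posdef x hx) (ctx.B ctx.posSum) _
    (fun i => B_posSum_simple i.2)
    (fun i j hij => simple_B_nonpos i.2 j.2 fun h => hij (Subtype.ext h))

variable (ctx) in
/-- The simple coroot attached to `α`, scaled so that long simple roots are unchanged. -/
def scaled (α : V) : V := (ctx.B ctx.θ ctx.θ / ctx.B α α) • α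

lemma scale_pos {α : V} (hα : α ∈ ctx.simple) : 0 < ctx.B ctx.θ ctx.θ / ctx.B α α :=
  div_pos (B_self_pos θ_mem) (B_self_pos (pos_mem hα.1))

variable (ctx) in
/-- The cone of nonnegative integer combinations of scaled simple coroots. -/
def longCone : AddSubmonoid V := AddSubmonoid.closure (Set.range fun i : ctx.simple => ctx.scaled i)

lemma posLong_mem_longCone {μ : V} (hμ : μ ∈ ctx.PosLong) : μ ∈ ctx.longCone := by
  have hfin : ctx.PosLong.Finite := Pos_finite.subset fun _ h => h.1
  refine (hfin.wellFoundedOn (r := ctx.slt)).induction (P := fun μ => μ ∈ ctx.longCone) hμ ?_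
  intro μ hμ ih
  obtain ⟨m, hm, hsum⟩ := AddSubmonoid.exists_multiset_of_mem_closure (pos_mem_closure_simple hμ.1)
  obtain ⟨α, hαm, hB⟩ := exists_mem_B_pos (ctx := ctx) μ m
    (by rw [hsum]; exact B_self_pos (pos_mem hμ.1))
  have hα := hm α hαm
  have hmem : ctx.scaled α ∈ ctx.longCone := AddSubmonoid.subset_closure ⟨⟨α, hα⟩, rfl⟩
  by_cases hne : μ = α
  · subst hne
    have h1 : ctx.scaled μ = μ := by
      rw [scaled, hμ.2, div_self (B_self_pos θ_mem).ne', one_smul]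
    exact h1 ▸ hmem
  · have hlong := sr_mem_posLong hα hμ hne
    have hlt : ctx.slt (ctx.sr α μ) μ := by
      have := slt_sr hα (pos_mem hlong.1) (by
        rw [B_sr_left, sr_self (pos_mem hα.1), map_neg]
        linarith)
      rwa [sr_sr] at this
    have hs : μ = ctx.sr α μ + ctx.scaled α := by
      rw [sr_eq_sub hα hμ hne hB, scaled]; abel
    rw [hs]
    exact add_mem (ih _ hlong hlt) hmem

lemma sub_mem_longCone {μ ν : V} (hμ : μ ∈ ctx.longCone) (hν : ν ∈ ctx.longCone)
    (h : μ - ν ∈ AddSubmonoid.closure ctx.Pos) : μ - ν ∈ ctx.longCone := by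
  have : Finite ctx.simple := (Pos_finite.subset simple_subset).to_subtype
  have := Fintype.ofFinite ctx.simple
  rw [← closure_simple, ← Subtype.range_coe (s := ctx.simple)] at h
  obtain ⟨c, hc⟩ := AddSubmonoid.exists_of_mem_closure_range _ _ h
  obtain ⟨a, rfl⟩ := AddSubmonoid.exists_of_mem_closure_range _ _ hμ
  obtain ⟨b, rfl⟩ := AddSubmonoid.exists_of_mem_closure_range _ _ hν
  have hli := Fintype.linearIndependent_iff.1 (linearIndependent_simple (ctx := ctx))
    (fun i => (ctx.B ctx.θ ctx.θ / ctx.B i i) * ((a i : ℚ) - b i) - c i) (by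
      rw [← sub_eq_zero, ← Finset.sum_sub_distrib, ← Finset.sum_sub_distrib] at hc
      rw [← hc]
      refine Finset.sum_congr rfl fun i _ => ?_
      simp only [scaled, ← Nat.cast_smul_eq_nsmul ℚ]
      module)
  have hle : ∀ i, b i ≤ a i := by
    intro i
    have h1 := hli i
    have h2 := scale_pos i.2
    have h3 : (0 : ℚ) ≤ c i := Nat.cast_nonneg _
    have h4 : (0 : ℚ) ≤ (a i : ℚ) - b i := by
      by_contra! hlt
      nlinarith
    exact_mod_cast sub_nonneg.1 h4
  rw [← Finset.sum_sub_distrib]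
  refine sum_mem fun i _ => ?_
  obtain ⟨k, hk⟩ := Nat.exists_eq_add_of_le (hle i)
  rw [hk, add_nsmul, add_sub_cancel_left]
  exact nsmul_mem (AddSubmonoid.subset_closure (Set.mem_range_self i)) _

lemma exists_multiset_of_mem_longCone {x : V} (hx : x ∈ ctx.longCone) :
    ∃ m : Multiset V, (∀ α ∈ m, α ∈ ctx.simple) ∧ x = (m.map ctx.scaled).sum := by
  induction hx using AddSubmonoid.closure_induction with
  | mem x h =>
    obtain ⟨α, rfl⟩ := h
    exact ⟨{(α : V)}, by simp, by simp⟩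
  | zero => exact ⟨0, by simp, by simp⟩
  | add a b _ _ ha hb =>
    obtain ⟨m, hm, rfl⟩ := ha
    obtain ⟨m', hm', rfl⟩ := hb
    refine ⟨m + m', fun α hα => ?_, by simp⟩
    rcases Multiset.mem_add.1 hα with h | h
    · exact hm α h
    · exact hm' α h

end SimpleCoordinates

section MinimalIdeal

variable {ctx}

variable (ctx) in
/-- The ideal attached to a minimal length representative `v`. -/
def minIdeal (v : V ≃ₗ[ℚ] V) : Set V :=
  {η | η ∈ ctx.Pos ∧ (η = ctx.θ ∨ -v (ctx.θ - η) ∈ ctx.Pos)}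

lemma IsMinRep.minIdeal_subset_sr {v : V ≃ₗ[ℚ] V} {μ α : V} (h : ctx.IsMinRep v μ)
    (hα : α ∈ ctx.simple) (hB : 0 < ctx.B α μ) : ctx.minIdeal v ⊆ ctx.minIdeal (ctx.sr α * v) := by
  rintro η ⟨hη, hη'⟩
  refine ⟨hη, ?_⟩
  by_cases hne : η = ctx.θ
  · exact Or.inl hne
  · right
    have hP := hη'.resolve_left hne
    rw [LinearEquiv.mul_apply, ← map_neg]
    refine sr_mem_pos hα hP fun he => ?_
    rw [← he, map_neg, LinearMap.neg_apply, h.B_θ, map_sub, LinearMap.sub_apply] at hB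
    have h1 := two_B_θ_le (pos_mem hη) hne
    have := B_self_pos (ctx := ctx) θ_mem
    linarith

lemma exists_minIdeal_subset (n : ℕ) : ∀ m : Multiset V, m.card = n →
    (∀ α ∈ m, α ∈ ctx.simple) → ∀ μ ∈ ctx.PosLong, ∀ ν ∈ ctx.PosLong,
    μ - ν = (m.map ctx.scaled).sum →
    ∃ v v', ctx.IsMinRep v μ ∧ ctx.IsMinRep v' ν ∧ ctx.minIdeal v ⊆ ctx.minIdeal v' := by
  induction n with
  | zero =>
    intro m hm _ μ hμ ν _ h
    rw [Multiset.card_eq_zero.1 hm, Multiset.map_zero, Multiset.sum_zero, sub_eq_zero] at h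
    subst h
    obtain ⟨v, hv⟩ := exists_isMinRep hμ
    exact ⟨v, v, hv, hv, subset_rfl⟩
  | succ n ih =>
    intro m hm hsimple μ hμ ν hν h
    by_cases hμν : μ = ν
    · subst hμν
      obtain ⟨v, hv⟩ := exists_isMinRep hμ
      exact ⟨v, v, hv, hv, subset_rfl⟩
    obtain ⟨b, hb, hB⟩ := exists_mem_B_pos (ctx := ctx) (μ - ν) (m.map ctx.scaled) (by
      rw [← h]; exact ctx.B_posdef _ (sub_ne_zero.2 hμν))
    obtain ⟨α, hαm, rfl⟩ := Multiset.mem_map.1 hb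
    have hα := hsimple α hαm
    obtain ⟨m', rfl⟩ := Multiset.exists_cons_of_mem hαm
    have hm' : m'.card = n := by simpa using hm
    have hsimple' : ∀ α ∈ m', α ∈ ctx.simple := fun β hβ => hsimple β (by simp [hβ])
    rw [Multiset.map_cons, Multiset.sum_cons] at h
    rw [scaled, map_smul, smul_eq_mul] at hB
    have hBα : 0 < ctx.B (μ - ν) α := pos_of_mul_pos_right hB (scale_pos hα).le
    rw [map_sub, LinearMap.sub_apply] at hBα
    by_cases hBμ : 0 < ctx.B μ α
    · have hne : μ ≠ α := by
        rintro rfl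
        have h1 : ctx.scaled μ = μ := by
          rw [scaled, hμ.2, div_self (B_self_pos θ_mem).ne', one_smul]
        have h2 : -ν = (m'.map ctx.scaled).sum := by
          rw [h1] at h
          exact add_left_cancel (a := μ) (by rw [← h]; abel)
        have h3 := B_posSum_pos hν.1
        obtain ⟨b, hb, hbB⟩ := exists_mem_B_pos (ctx := ctx) (-ctx.posSum) (m'.map ctx.scaled)
          (by rw [← h2]; simpa using h3)
        obtain ⟨β, hβ, rfl⟩ := Multiset.mem_map.1 hb
        have h4 := mul_pos (scale_pos (hsimple' β hβ)) (B_posSum_simple (hsimple' β hβ))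
        rw [scaled, map_smul, smul_eq_mul, map_neg, LinearMap.neg_apply] at hbB
        linarith
      have hs := sr_eq_sub hα hμ hne hBμ
      obtain ⟨v₁, v', hv₁, hv', hsub⟩ := ih m' hm' hsimple' _ (sr_mem_posLong hα hμ hne) ν hν (by
        rw [hs, ← scaled, sub_right_comm, h, add_sub_cancel_left])
      have hB₁ : ctx.B α (ctx.sr α μ) ≠ 0 := by
        rw [← B_sr_left, sr_self (pos_mem hα.1), map_neg, LinearMap.neg_apply, ctx.B_symm]
        linarith
      have hv := hv₁.sr_mul hα hB₁
      rw [sr_sr] at hv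
      refine ⟨_, v', hv, hv', (hv.minIdeal_subset_sr hα (by rwa [ctx.B_symm])).trans ?_⟩
      rwa [← mul_assoc, sr_mul_self, one_mul]
    · have hBν : ctx.B ν α < 0 := by linarith
      have hne : ν ≠ α := by
        rintro rfl
        exact absurd (B_self_pos (pos_mem hν.1)) (not_lt.2 hBν.le)
      have hs := sr_eq_add hα hν hBν
      obtain ⟨v, v₁, hv, hv₁, hsub⟩ := ih m' hm' hsimple' μ hμ _ (sr_mem_posLong hα hν hne) (by
        rw [hs, ← scaled, ← sub_sub, h, add_sub_cancel_left])
      have hB₁ : 0 < ctx.B α (ctx.sr α ν) := by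
        rw [← B_sr_left, sr_self (pos_mem hα.1), map_neg, LinearMap.neg_apply, ctx.B_symm]
        linarith
      have hv' := hv₁.sr_mul hα hB₁.ne'
      rw [sr_sr] at hv'
      exact ⟨v, _, hv, hv', hsub.trans (hv₁.minIdeal_subset_sr hα hB₁)⟩

lemma exists_minIdeal_subset_of_le {μ ν : V} (hμ : μ ∈ ctx.PosLong) (hν : ν ∈ ctx.PosLong)
    (h : ctx.le ν μ) :
    ∃ v v', ctx.IsMinRep v μ ∧ ctx.IsMinRep v' ν ∧ ctx.minIdeal v ⊆ ctx.minIdeal v' := by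
  obtain ⟨m, hm, hs⟩ := exists_multiset_of_mem_longCone
    (sub_mem_longCone (posLong_mem_longCone hμ) (posLong_mem_longCone hν) h)
  exact exists_minIdeal_subset _ m rfl hm μ hμ ν hν hs

lemma le_of_minIdeal_subset {μ ν : V} (hμ : μ ∈ ctx.PosLong) {v v' : V ≃ₗ[ℚ] V}
    (hv : ctx.IsMinRep v μ) (hv' : ctx.IsMinRep v' ν) (h : ctx.minIdeal v ⊆ ctx.minIdeal v') :
    ctx.le ν μ := by
  obtain ⟨l, hl, hw⟩ := exists_word (mul_mem hv'.mem (inv_mem hv.mem))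
  have happ : ∀ x, ctx.word l x = v' (v.symm x) := fun x => by rw [hw]; rfl
  have key := sub_word_mem_closure _ l rfl hl μ (pos_mem hμ.1) (by
    intro β hβ hneg
    rw [happ] at hneg
    by_contra! hB
    have hγ := hv.neg_symm_pos (pos_mem hβ) hB
    have hγθ : -v.symm β ≠ ctx.θ := by
      intro he
      have h1 := hv.map_θ
      rw [← he, map_neg, LinearEquiv.apply_symm_apply] at h1
      exact ctx.pos_not_neg β hβ (h1 ▸ hμ.1)
    have hγB : ctx.B (-v.symm β) ctx.θ = -ctx.B β μ := by
      rw [map_neg, LinearMap.neg_apply, hv.B_symm]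
    have hle := two_B_θ_le (pos_mem hγ) hγθ
    have hθ := B_self_pos (ctx := ctx) θ_mem
    have hηΔ : ctx.θ - (-v.symm β) ∈ ctx.Δ :=
      sub_mem_of_B_pos θ_mem (pos_mem hγ) hγθ.symm (by rw [ctx.B_symm, hγB]; linarith)
    have hη : ctx.θ - (-v.symm β) ∈ ctx.Pos := by
      exact pos_of_mem_closure hηΔ (ctx.θ_highest _ (pos_mem hγ))
    have hmem : ctx.θ - (-v.symm β) ∈ ctx.minIdeal v := by
      refine ⟨hη, Or.inr ?_⟩
      rwa [sub_sub_cancel, map_neg, neg_neg, LinearEquiv.apply_symm_apply]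
    rcases (h hmem).2 with h1 | h1
    · exact ne_zero_of_mem (pos_mem hγ) (by simpa using h1)
    · rw [sub_sub_cancel, map_neg, neg_neg] at h1
      exact ctx.pos_not_neg _ h1 hneg)
  rwa [happ, ← hv.map_θ, LinearEquiv.symm_apply_apply, hv'.map_θ, hv.map_θ] at key

end MinimalIdeal

section AffineRoots

variable {ctx}

lemma refl_apply {β : V × ℚ × ℚ} (h : ctx.Bhat β β ≠ 0) (x : V × ℚ × ℚ) :
    ctx.refl β x = x - (2 / ctx.Bhat β β * ctx.Bhat β x) • β := by
  rw [refl, dif_neg h, Module.reflection_apply]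
  rfl

lemma refl_refl (β x : V × ℚ × ℚ) : ctx.refl β (ctx.refl β x) = x := by
  rw [refl]
  split_ifs with h
  · rfl
  · exact Module.involutive_reflection _ x

lemma refl_mk {b : V} (hb : b ∈ ctx.Δ) (j : ℚ) (a : V) (k : ℚ) :
    ctx.refl (b, j, 0) (a, k, 0)
      = (a - (2 * ctx.B a b / ctx.B b b) • b, k - 2 * ctx.B a b / ctx.B b b * j, 0) := by
  have hB : ∀ (c : V) (i : ℚ), ctx.Bhat (b, j, 0) (c, i, 0) = ctx.B c b := by
    intro c i
    simp [Bhat, ctx.B_symm b c]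
  rw [refl_apply (by rw [hB]; exact (B_self_pos hb).ne'), hB, hB, div_mul_eq_mul_div]
  simp

lemma What_mem_Δhat {g : (V × ℚ × ℚ) ≃ₗ[ℚ] (V × ℚ × ℚ)} (hg : g ∈ ctx.What) :
    ∀ x ∈ ctx.Δhat, g x ∈ ctx.Δhat := by
  have key : ∀ β ∈ ctx.Δhat, ∀ x ∈ ctx.Δhat, ctx.refl β x ∈ ctx.Δhat := by
    rintro _ ⟨b, hb, j, rfl⟩ _ ⟨a, ha, k, rfl⟩
    obtain ⟨n, hn⟩ := ctx.crystallographic a ha b hb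
    refine ⟨_, sr_mem hb ha, k - n * j, ?_⟩
    rw [refl_mk hb, sr_apply, hn]
    push_cast
    rfl
  induction hg using Subgroup.closure_induction'' with
  | one => intro x hx; exact hx
  | mem g hg => obtain ⟨β, hβ, rfl⟩ := hg; exact key β hβ
  | inv_mem g hg =>
    obtain ⟨β, hβ, rfl⟩ := hg
    rw [inv_eq_of_mul_eq_one_left (a := ctx.refl β) (LinearEquiv.ext (refl_refl β))]
    exact key β hβ
  | mul a b _ _ ha hb => intro x hx; exact ha _ (hb x hx)

lemma mk_mem_PosHat {a : V} {k : ℤ} :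
    ((a, (k : ℚ), 0) : V × ℚ × ℚ) ∈ ctx.PosHat ↔ (k = 0 ∧ a ∈ ctx.Pos) ∨ (1 ≤ k ∧ a ∈ ctx.Δ) := by
  constructor
  · rintro (⟨b, hb, h⟩ | ⟨b, hb, j, hj, h⟩)
    · simp only [Prod.mk.injEq, Int.cast_eq_zero, and_true] at h
      exact Or.inl ⟨h.2, h.1 ▸ hb⟩
    · simp only [Prod.mk.injEq, Int.cast_inj, and_true] at h
      exact Or.inr ⟨h.2 ▸ hj, h.1 ▸ hb⟩
  · rintro (⟨rfl, h⟩ | ⟨hk, h⟩)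
    · exact Or.inl ⟨a, h, by simp⟩
    · exact Or.inr ⟨a, h, k, hk, rfl⟩

lemma mem_PosHat_or_neg_mem {x : V × ℚ × ℚ} (hx : x ∈ ctx.Δhat) :
    x ∈ ctx.PosHat ∨ -x ∈ ctx.PosHat := by
  obtain ⟨a, ha, k, rfl⟩ := hx
  have e : -((a, (k : ℚ), 0) : V × ℚ × ℚ) = (-a, ((-k : ℤ) : ℚ), 0) := by simp
  rw [e, mk_mem_PosHat, mk_mem_PosHat]
  have := ctx.neg_mem_Δ a ha
  rcases lt_trichotomy k 0 with h | h | h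
  · exact Or.inr (Or.inr ⟨by omega, this⟩)
  · rcases ctx.mem_pos_or_neg_pos a ha with h' | h'
    · exact Or.inl (Or.inl ⟨h, h'⟩)
    · exact Or.inr (Or.inl ⟨by omega, h'⟩)
  · exact Or.inl (Or.inr ⟨by omega, ha⟩)

lemma δhat_sub_emb (η : V) : ctx.δhat - ctx.emb η = (-η, ((1 : ℤ) : ℚ), 0) := by
  simp [δhat, emb]

lemma alpha0_eq : ctx.alpha0 = ctx.δhat - ctx.emb ctx.θ := by simp [alpha0, δhat, emb]

lemma exists_pairing_θ {a : V} (ha : a ∈ ctx.Δ) : ∃ n : ℤ,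
    2 * ctx.B a ctx.θ / ctx.B ctx.θ ctx.θ = n ∧
      (a = ctx.θ ∧ n = 2 ∨ a = -ctx.θ ∧ n = -2 ∨ -1 ≤ n ∧ n ≤ 1) := by
  have hθ := B_self_pos (ctx := ctx) θ_mem
  obtain ⟨n, hn⟩ := ctx.crystallographic a ha _ θ_mem
  refine ⟨n, hn, ?_⟩
  rw [div_eq_iff hθ.ne'] at hn
  by_cases h1 : a = ctx.θ
  · refine Or.inl ⟨h1, ?_⟩
    rw [h1] at hn
    exact_mod_cast (mul_right_cancel₀ hθ.ne' hn).symm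
  · by_cases h2 : a = -ctx.θ
    · refine Or.inr (Or.inl ⟨h2, ?_⟩)
      rw [h2, map_neg, LinearMap.neg_apply, mul_neg, ← neg_mul] at hn
      exact_mod_cast (mul_right_cancel₀ hθ.ne' hn).symm
    · have h3 := two_B_θ_le ha h1
      have h4 := neg_B_θ_le ha h2
      rw [hn] at h3 h4
      have h5 : (n : ℚ) ≤ 1 := by
        by_contra! hlt
        nlinarith
      have h6 : (-1 : ℚ) ≤ n := by
        by_contra! hlt
        nlinarith
      exact Or.inr (Or.inr ⟨by exact_mod_cast h6, by exact_mod_cast h5⟩)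

end AffineRoots

section MinusculeElement

variable {ctx}

/-- The extension of a linear automorphism of `V` fixing `δ` and `λ`. -/
def lift (v : V ≃ₗ[ℚ] V) : (V × ℚ × ℚ) ≃ₗ[ℚ] (V × ℚ × ℚ) :=
  LinearEquiv.prodCongr v (LinearEquiv.refl ℚ (ℚ × ℚ))

lemma lift_sr {α : V} (hα : α ∈ ctx.Δ) : lift (ctx.sr α) = ctx.refl (α, 0, 0) := by
  have hB : ∀ x : V × ℚ × ℚ, ctx.Bhat (α, 0, 0) x = ctx.B x.1 α := by
    intro x
    simp [Bhat, ctx.B_symm α]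
  refine LinearEquiv.ext fun x => ?_
  rw [refl_apply (by rw [hB]; exact (B_self_pos hα).ne'), hB, hB, div_mul_eq_mul_div]
  ext <;> simp [lift, sr_apply]

lemma lift_mem_What {v : V ≃ₗ[ℚ] V} (hv : v ∈ ctx.weyl) : lift v ∈ ctx.What := by
  induction hv using Subgroup.closure_induction with
  | mem g hg =>
    obtain ⟨α, hα, rfl⟩ := hg
    exact Subgroup.subset_closure ⟨_, ⟨α, pos_mem hα.1, 0, by simp⟩, lift_sr (pos_mem hα.1)⟩
  | one => exact one_mem _
  | mul a b _ _ ha hb => exact mul_mem ha hb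
  | inv a _ ha => exact inv_mem ha

variable (ctx) in
/-- The affine Weyl group element `v s₀`. -/
noncomputable def minElt (v : V ≃ₗ[ℚ] V) : (V × ℚ × ℚ) ≃ₗ[ℚ] (V × ℚ × ℚ) :=
  lift v * ctx.refl ctx.alpha0

lemma minElt_mem_What {v : V ≃ₗ[ℚ] V} (hv : v ∈ ctx.weyl) : ctx.minElt v ∈ ctx.What :=
  mul_mem (lift_mem_What hv)
    (Subgroup.subset_closure ⟨_, ⟨_, ctx.neg_mem_Δ _ θ_mem, 1, by simp [alpha0]⟩, rfl⟩)

lemma neg_minElt_mk (v : V ≃ₗ[ℚ] V) (a : V) (k n : ℤ)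
    (hn : 2 * ctx.B a ctx.θ / ctx.B ctx.θ ctx.θ = n) :
    -ctx.minElt v (a, (k : ℚ), 0) = (-v (a - n • ctx.θ), ((-(k + n) : ℤ) : ℚ), 0) := by
  rw [minElt, LinearEquiv.mul_apply, alpha0, refl_mk (ctx.neg_mem_Δ _ θ_mem)]
  have e : 2 * ctx.B a (-ctx.θ) / ctx.B (-ctx.θ) (-ctx.θ) = -n := by
    rw [← hn]
    simp [neg_div]
  rw [e]
  simp [lift, Int.cast_smul_eq_zsmul]

lemma IsMinRep.mem_Nhat_minElt {v : V ≃ₗ[ℚ] V} {μ : V} (h : ctx.IsMinRep v μ) (hμ : μ ∈ ctx.Pos)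
    {x : V × ℚ × ℚ} (hx : x ∈ ctx.Nhat (ctx.minElt v)) :
    ∃ η ∈ ctx.minIdeal v, x = ctx.δhat - ctx.emb η := by
  obtain ⟨hx, hx'⟩ := hx
  have hΔ : ∃ a ∈ ctx.Δ, ∃ k : ℤ, x = (a, (k : ℚ), 0) := by
    rcases hx with ⟨a, ha, rfl⟩ | ⟨a, ha, k, -, rfl⟩
    · exact ⟨a, pos_mem ha, 0, by simp⟩
    · exact ⟨a, ha, k, rfl⟩
  obtain ⟨a, ha, k, rfl⟩ := hΔ
  obtain ⟨n, hn, hcases⟩ := exists_pairing_θ ha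
  have hθ := B_self_pos (ctx := ctx) θ_mem
  rw [neg_minElt_mk v a k n hn, mk_mem_PosHat] at hx'
  rw [mk_mem_PosHat] at hx
  rw [div_eq_iff hθ.ne'] at hn
  have hpos : a ∈ ctx.Pos → 0 ≤ n := by
    intro hp
    have h1 := θ_dominant hp
    rw [ctx.B_symm] at h1
    have h2 : (0 : ℚ) ≤ n := by
      by_contra! hlt
      nlinarith
    exact_mod_cast h2
  rcases hcases with ⟨-, rfl⟩ | ⟨rfl, rfl⟩ | ⟨hn1, hn2⟩
  · omega
  · rcases hx with ⟨-, hp⟩ | ⟨hk, -⟩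
    · exact absurd hp (ctx.pos_not_neg _ ctx.θ_pos)
    · rcases hx' with ⟨hk', hp⟩ | ⟨hk', -⟩
      · rw [neg_smul, two_smul, sub_neg_eq_add, neg_add_cancel_left, h.map_θ] at hp
        exact absurd hp (ctx.pos_not_neg _ hμ)
      · obtain rfl : k = 1 := by omega
        exact ⟨ctx.θ, ⟨ctx.θ_pos, Or.inl rfl⟩, (δhat_sub_emb _).symm⟩
  · rcases hx with ⟨rfl, hp⟩ | ⟨hk, -⟩
    · have := hpos hp
      obtain rfl : n = 0 := by omega
      have hva : -v a ∈ ctx.Pos := by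
        have := hx'.resolve_right (by omega)
        simpa using this.2
      have h0 : ctx.B a ctx.θ = 0 := by simpa using hn
      have := h.symm_pos _ hva (by rw [map_neg, LinearMap.neg_apply, h.B_θ, h0, neg_zero])
      rw [map_neg, LinearEquiv.symm_apply_apply] at this
      exact absurd this (ctx.pos_not_neg _ hp)
    · obtain rfl : n = -1 := by omega
      obtain rfl : k = 1 := by omega
      have hη : -a ∈ ctx.Pos := (ctx.mem_pos_or_neg_pos a ha).resolve_left fun hp => by
        have := hpos hp
        omega
      refine ⟨-a, ⟨hη, Or.inr ?_⟩, ?_⟩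
      · have := (hx'.resolve_right (by omega)).2
        rwa [neg_smul, one_smul, sub_neg_eq_add, add_comm, ← sub_neg_eq_add] at this
      · rw [δhat_sub_emb, neg_neg]

lemma IsMinRep.sub_emb_mem_Nhat_minElt {v : V ≃ₗ[ℚ] V} {μ : V} (h : ctx.IsMinRep v μ)
    (hμ : μ ∈ ctx.Pos) {η : V} (hη : η ∈ ctx.minIdeal v) :
    ctx.δhat - ctx.emb η ∈ ctx.Nhat (ctx.minElt v) := by
  obtain ⟨hp, hη⟩ := hη
  have hηΔ := ctx.neg_mem_Δ _ (pos_mem hp)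
  have hθ := B_self_pos (ctx := ctx) θ_mem
  rw [δhat_sub_emb]
  refine ⟨mk_mem_PosHat.2 (Or.inr ⟨le_rfl, hηΔ⟩), ?_⟩
  obtain ⟨n, hn, hcases⟩ := exists_pairing_θ hηΔ
  rw [neg_minElt_mk v _ 1 n hn, mk_mem_PosHat]
  rw [div_eq_iff hθ.ne'] at hn
  by_cases hηθ : η = ctx.θ
  · subst hηθ
    have hn2 : n = -2 := by
      rw [map_neg, LinearMap.neg_apply, mul_neg, ← neg_mul] at hn
      exact_mod_cast (mul_right_cancel₀ hθ.ne' hn).symm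
    subst hn2
    refine Or.inr ⟨le_rfl, ?_⟩
    rw [neg_smul, two_smul, sub_neg_eq_add, neg_add_cancel_left, h.map_θ]
    exact ctx.neg_mem_Δ _ (pos_mem hμ)
  · replace hη := hη.resolve_left hηθ
    have hΔ : ctx.θ - η ∈ ctx.Δ := by
      have := weyl_symm_mem h.mem _ (ctx.neg_mem_Δ _ (pos_mem hη))
      rwa [neg_neg, LinearEquiv.symm_apply_apply] at this
    have hle := two_B_θ_le hΔ fun he => ne_zero_of_mem (pos_mem hp) (by simpa using he)
    rw [map_sub, LinearMap.sub_apply] at hle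
    rw [map_neg, LinearMap.neg_apply] at hn
    have hn0 : (n : ℚ) < 0 := by
      by_contra! hlt
      nlinarith
    have hn0' : n < 0 := by exact_mod_cast hn0
    rcases hcases with ⟨-, rfl⟩ | ⟨he, -⟩ | ⟨hn1, hn2⟩
    · omega
    · exact absurd (neg_injective he) hηθ
    · obtain rfl : n = -1 := by omega
      refine Or.inl ⟨by norm_num, ?_⟩
      rwa [neg_smul, one_smul, sub_neg_eq_add, add_comm, ← sub_eq_add_neg]

lemma IsMinRep.minIdeal_mem_AbFiber {v : V ≃ₗ[ℚ] V} {μ : V} (h : ctx.IsMinRep v μ)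
    (hμ : μ ∈ ctx.Pos) : ctx.minIdeal v ∈ ctx.AbFiber μ := by
  refine ⟨⟨ctx.θ, ctx.θ_pos, Or.inl rfl⟩, ctx.minElt v, ⟨minElt_mem_What h.mem, fun β hβ => ?_⟩,
    Set.Subset.antisymm ?_ fun η hη => ⟨hη.1, h.sub_emb_mem_Nhat_minElt hμ hη⟩, ?_⟩
  · obtain ⟨η, hη, rfl⟩ := h.mem_Nhat_minElt hμ hβ
    exact ⟨η, hη.1, rfl⟩
  · rintro γ ⟨-, hγ⟩
    obtain ⟨η, hη, he⟩ := h.mem_Nhat_minElt hμ hγ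
    rw [δhat_sub_emb, δhat_sub_emb] at he
    rwa [neg_injective (Prod.mk.inj he).1]
  · have hθ := B_self_pos (ctx := ctx) θ_mem
    have := neg_minElt_mk v (-ctx.θ) 1 (-2) (by
      rw [map_neg, LinearMap.neg_apply, mul_neg, neg_div, mul_div_assoc, div_self hθ.ne']
      norm_num)
    rw [neg_smul, two_smul, sub_neg_eq_add, neg_add_cancel_left, h.map_θ, ← δhat_sub_emb,
      ← alpha0_eq, neg_eq_iff_eq_neg] at this
    rw [this]
    simp [δhat, emb]

end MinusculeElement

section Counting

variable {ctx}

variable (ctx) in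
/-- The positive roots having negative inner product with `μ`, together with `0`. -/
def negPairing (μ : V) : Set V := insert 0 {β | β ∈ ctx.Pos ∧ ctx.B β μ < 0}

lemma IsMinRep.ncard_minIdeal_le {v : V ≃ₗ[ℚ] V} {μ : V} (h : ctx.IsMinRep v μ) :
    (ctx.minIdeal v).ncard ≤ (ctx.negPairing μ).ncard := by
  refine Set.ncard_le_ncard_of_injOn (fun η => -v (ctx.θ - η)) ?_ ?_
    ((Pos_finite.subset fun _ h => h.1).insert 0)
  · rintro η ⟨hp, hη⟩
    by_cases hηθ : η = ctx.θ
    · exact Or.inl (by simp [hηθ])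
    · refine Or.inr ⟨hη.resolve_left hηθ, ?_⟩
      rw [map_neg, LinearMap.neg_apply, h.B_θ, map_sub, LinearMap.sub_apply]
      have := two_B_θ_le (pos_mem hp) hηθ
      have := B_self_pos (ctx := ctx) θ_mem
      linarith
  · intro η _ η' _ he
    exact sub_right_injective (v.injective (neg_injective he))

lemma IsMinuscule.exists_mem_idealOf {w : (V × ℚ × ℚ) ≃ₗ[ℚ] (V × ℚ × ℚ)}
    (hw : ctx.IsMinuscule w) {x : V × ℚ × ℚ} (hx : x ∈ ctx.PosHat) (hx' : -w x ∈ ctx.PosHat) :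
    ∃ η ∈ ctx.idealOf w, w (ctx.δhat - ctx.emb η) = w x := by
  obtain ⟨η, hη, rfl⟩ := hw.2 x ⟨hx, hx'⟩
  exact ⟨η, ⟨hη, hx, hx'⟩, rfl⟩

lemma IsMinuscule.exists_of_mem_negPairing {w : (V × ℚ × ℚ) ≃ₗ[ℚ] (V × ℚ × ℚ)} {μ : V}
    (hw : ctx.IsMinuscule w) (hμ : μ ∈ ctx.Pos) (h0 : w ctx.alpha0 + ctx.δhat = ctx.emb μ)
    {β : V} (hβ : β ∈ ctx.negPairing μ) :
    ∃ η ∈ ctx.idealOf w, w (ctx.δhat - ctx.emb η) = -ctx.emb β ∨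
      w (ctx.δhat - ctx.emb η) = -(ctx.δhat - ctx.emb (β + μ)) := by
  have h0' : w ctx.alpha0 = -(ctx.δhat - ctx.emb μ) := by rw [neg_sub, ← h0, add_sub_cancel_right]
  rcases hβ with rfl | ⟨hβ, hB⟩
  · obtain ⟨η, hη, he⟩ := hw.exists_mem_idealOf (x := ctx.alpha0)
      (by rw [alpha0_eq, δhat_sub_emb]
          exact mk_mem_PosHat.2 (Or.inr ⟨le_rfl, ctx.neg_mem_Δ _ θ_mem⟩))
      (by rw [h0', neg_neg, δhat_sub_emb]
          exact mk_mem_PosHat.2 (Or.inr ⟨le_rfl, ctx.neg_mem_Δ _ (pos_mem hμ)⟩))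
    exact ⟨η, hη, Or.inr (by rw [he, h0', zero_add])⟩
  · have hβμ : β + μ ∈ ctx.Δ := add_mem_of_B_neg (pos_mem hβ) (pos_mem hμ)
      (fun he => ctx.pos_not_neg μ hμ (he ▸ hβ)) hB
    have hinv := What_mem_Δhat (inv_mem hw.1)
    have hmul : ∀ x, w (w⁻¹ x) = x := fun x => w.apply_symm_apply x
    rcases mem_PosHat_or_neg_mem (hinv (ctx.emb β) ⟨β, pos_mem hβ, 0, by simp [emb]⟩) with hx | hx
    · have hy : w⁻¹ (ctx.emb β) + ctx.alpha0 = w⁻¹ (-(ctx.δhat - ctx.emb (β + μ))) := by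
        apply w.injective
        rw [map_add, hmul, hmul, h0']
        simp [emb, δhat]
      have hmem := hinv (-(ctx.δhat - ctx.emb (β + μ))) ⟨β + μ, hβμ, -1, by simp [emb, δhat]⟩
      obtain ⟨a, ha, k, he⟩ := hmem
      have hk : 1 ≤ k := by
        rw [← hy] at he
        rcases hx with ⟨b, hb, e⟩ | ⟨b, hb, j, hj, e⟩ <;>
          rw [e] at he <;> simp only [alpha0, Prod.mk_add_mk, Prod.mk.injEq] at he
        · have : ((0 : ℚ) + 1) = k := he.2.1
          rw [zero_add] at this
          exact_mod_cast this.le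
        · have h2 : j + 1 = k := by exact_mod_cast he.2.1
          omega
      obtain ⟨η, hη, h1⟩ := hw.exists_mem_idealOf (x := w⁻¹ (-(ctx.δhat - ctx.emb (β + μ))))
        (by rw [he]; exact mk_mem_PosHat.2 (Or.inr ⟨hk, ha⟩))
        (by rw [hmul, neg_neg, δhat_sub_emb]
            exact mk_mem_PosHat.2 (Or.inr ⟨le_rfl, ctx.neg_mem_Δ _ hβμ⟩))
      exact ⟨η, hη, Or.inr (by rw [h1, hmul])⟩
    · obtain ⟨η, hη, h1⟩ := hw.exists_mem_idealOf hx
        (by rw [map_neg, hmul, neg_neg]; exact Or.inl ⟨β, hβ, rfl⟩)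
      exact ⟨η, hη, Or.inl (by rw [h1, map_neg, hmul])⟩

lemma IsMinuscule.ncard_negPairing_le {w : (V × ℚ × ℚ) ≃ₗ[ℚ] (V × ℚ × ℚ)} {μ : V}
    (hw : ctx.IsMinuscule w) (hμ : μ ∈ ctx.Pos) (h0 : w ctx.alpha0 + ctx.δhat = ctx.emb μ) :
    (ctx.negPairing μ).ncard ≤ (ctx.idealOf w).ncard := by
  choose! f hf hf' using fun β (hβ : β ∈ ctx.negPairing μ) =>
    hw.exists_of_mem_negPairing hμ h0 hβ
  refine Set.ncard_le_ncard_of_injOn f hf ?_ (Pos_finite.subset fun _ h => h.1)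
  intro β hβ β' hβ' he
  have h1 := hf' β hβ
  have h2 := hf' β' hβ'
  rw [he] at h1
  rcases h1 with h1 | h1 <;> rcases h2 with h2 | h2 <;> rw [h1] at h2
  · simpa [emb] using h2
  · simp [emb, δhat] at h2
  · simp [emb, δhat] at h2
  · simpa [emb, δhat] using h2

lemma IsMinRep.minIdeal_eq {v : V ≃ₗ[ℚ] V} {μ : V} (h : ctx.IsMinRep v μ) (hμ : μ ∈ ctx.Pos)
    {I : Set V} (hI : I ∈ ctx.AbFiber μ) (hmin : ∀ J ∈ ctx.AbFiber μ, I ⊆ J) :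
    I = ctx.minIdeal v := by
  obtain ⟨-, w, hw, rfl, h0⟩ := hI
  exact Set.eq_of_subset_of_ncard_le (hmin _ (h.minIdeal_mem_AbFiber hμ))
    (h.ncard_minIdeal_le.trans (hw.ncard_negPairing_le hμ h0)) (Pos_finite.subset fun _ h => h.1)

end Counting

end RootSystemCtx

/-- `I(μ)_min ⊆ I(ν)_min` if and only if `ν ≼ μ`; the poset of
`μ`-minimal ideals is anti-isomorphic to `(Δ⁺_l, ≼)`. -/
theorem statement_18 {V : Type*} [AddCommGroup V] [Module ℚ V] (ctx : RootSystemCtx V)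
    (μ ν : V) (hμ : μ ∈ ctx.PosLong) (hν : ν ∈ ctx.PosLong)
    (Iμ Iν : Set V)
    (hIμ : Iμ ∈ ctx.AbFiber μ) (hμmin : ∀ I ∈ ctx.AbFiber μ, Iμ ⊆ I)
    (hIν : Iν ∈ ctx.AbFiber ν) (hνmin : ∀ I ∈ ctx.AbFiber ν, Iν ⊆ I) :
    Iμ ⊆ Iν ↔ ctx.le ν μ := by
  constructor
  · intro h
    obtain ⟨v, hv⟩ := RootSystemCtx.exists_isMinRep hμ
    obtain ⟨v', hv'⟩ := RootSystemCtx.exists_isMinRep hν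
    rw [hv.minIdeal_eq hμ.1 hIμ hμmin, hv'.minIdeal_eq hν.1 hIν hνmin] at h
    exact RootSystemCtx.le_of_minIdeal_subset hμ hv hv' h
  · intro h
    obtain ⟨v, v', hv, hv', hsub⟩ := RootSystemCtx.exists_minIdeal_subset_of_le hμ hν h
    rwa [hv.minIdeal_eq hμ.1 hIμ hμmin, hv'.minIdeal_eq hν.1 hIν hνmin]
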